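/- Let n ≥ 1, let 0 ≤ k ≤ n be an integer, let m be a positive integer, and let a ∈ ½ℤ with a ≥ 0. Then, as an identity of rational functions in ℚ(x_1^{1/2},…,x_n^{1/2}), the sum of the intermediate symplectic characters sp^{(k,n−k)}_{λ+(a^n)}(x_1,…,x_k | x_{k+1},…,x_n) over all partitions λ in the union Even′((m^n)) ∪ Odd′((m^n)) equals so^D_{((m/2)^n)}(x_1,…,x_n) · sp_{((m/2+a)^k)}(x_1,…,x_k) · (x_{k+1}⋯x_n)^{m/2+a}. -/

import Mathlib

open Matrix BigOperators
open scoped Classical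

noncomputable section

/-- The field `ℚ(t_1, …, t_n)` of rational functions in `n` indeterminates over `ℚ`. -/
abbrev FF (n : ℕ) : Type := FractionRing (MvPolynomial (Fin n) ℚ)

/-- The `i`-th indeterminate, viewed as an element of `FF n`. -/
def gen (n : ℕ) (i : Fin n) : FF n :=
  algebraMap (MvPolynomial (Fin n) ℚ) (FF n) (MvPolynomial.X i)

variable {F : Type*} [Field F]

/-- Symplectic character `sp_λ(x_1, …, x_N)`, in "doubled" form: `z i` represents
`x_i^{1/2}` and `μ i` represents `2·λ_i` (so half-integer weights are allowed). -/
def spD {N : ℕ} (z : Fin N → F) (μ : Fin N → ℤ) : F :=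
  Matrix.det (Matrix.of fun i j : Fin N =>
      z j ^ (μ i + 2 * ((N : ℤ) - (i : ℕ))) - z j ^ (-(μ i + 2 * ((N : ℤ) - (i : ℕ))))) /
  Matrix.det (Matrix.of fun i j : Fin N =>
      z j ^ (2 * ((N : ℤ) - (i : ℕ))) - z j ^ (-(2 * ((N : ℤ) - (i : ℕ)))))

/-- Odd orthogonal character `so^B_λ(x_1, …, x_N)`, in "doubled" form: `z i` represents
`x_i^{1/2}` and `μ i` represents `2·λ_i`. -/
def soBD {N : ℕ} (z : Fin N → F) (μ : Fin N → ℤ) : F :=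
  Matrix.det (Matrix.of fun i j : Fin N =>
      z j ^ (μ i + 2 * ((N : ℤ) - (i : ℕ)) - 1) -
        z j ^ (-(μ i + 2 * ((N : ℤ) - (i : ℕ)) - 1))) /
  Matrix.det (Matrix.of fun i j : Fin N =>
      z j ^ (2 * ((N : ℤ) - (i : ℕ)) - 1) - z j ^ (-(2 * ((N : ℤ) - (i : ℕ)) - 1)))

/-- Even orthogonal character `so^D_λ(x_1, …, x_N)`, in "doubled" form: `z i` represents
`x_i^{1/2}` and `μ i` represents `2·λ_i`; the factor is `2` if `λ_N > 0` and `1` otherwise. -/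
def soDD {N : ℕ} (z : Fin N → F) (μ : Fin N → ℤ) : F :=
  (if h : 0 < N then (if 0 < μ ⟨N - 1, Nat.sub_lt h Nat.one_pos⟩ then (2 : F) else 1) else 1) *
  (Matrix.det (Matrix.of fun i j : Fin N =>
      z j ^ (μ i + 2 * ((N : ℤ) - 1 - (i : ℕ))) +
        z j ^ (-(μ i + 2 * ((N : ℤ) - 1 - (i : ℕ))))) /
   Matrix.det (Matrix.of fun i j : Fin N =>
      z j ^ (2 * ((N : ℤ) - 1 - (i : ℕ))) + z j ^ (-(2 * ((N : ℤ) - 1 - (i : ℕ))))))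

/-- The matrix `Ā_λ` of the bialternant formula for the intermediate symplectic character
`sp^{(k, N-k)}`, in "doubled" form: `z i` represents `x_i^{1/2}`, `μ i` represents `2·λ_i`. -/
def interMatD {N : ℕ} (k : ℕ) (z : Fin N → F) (μ : Fin N → ℤ) : Matrix (Fin N) (Fin N) F :=
  Matrix.of fun i j : Fin N =>
    if (j : ℕ) < k then
      z j ^ (μ i + 2 * ((k : ℤ) - (i : ℕ))) /
          ∏ l ∈ Finset.univ.filter (fun l : Fin N => k ≤ (l : ℕ)), (1 - (z j ^ 2)⁻¹ * z l ^ 2) -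
        z j ^ (-(μ i + 2 * ((k : ℤ) - (i : ℕ)))) /
          ∏ l ∈ Finset.univ.filter (fun l : Fin N => k ≤ (l : ℕ)), (1 - z j ^ 2 * z l ^ 2)
    else z j ^ (μ i + 2 * ((N : ℤ) - 1 - (i : ℕ)))

/-- Intermediate symplectic character `sp^{(k, N-k)}_λ(x_1, …, x_k | x_{k+1}, …, x_N)`, in
"doubled" form: `z i` represents `x_i^{1/2}` and `μ i` represents `2·λ_i`. -/
def spInterD {N : ℕ} (k : ℕ) (z : Fin N → F) (μ : Fin N → ℤ) : F :=
  (interMatD k z μ).det / (interMatD k z fun _ => 0).det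


/-- The product of `f i j` over all pairs `i < j`. -/
def pairProd {n : ℕ} (f : Fin n → Fin n → F) : F :=
  ∏ i, ∏ j, if i < j then f i j else 1

theorem pairProd_succAbove {n : ℕ} (f : Fin (n + 1) → Fin (n + 1) → F) (i : Fin (n + 1)) :
    pairProd f = pairProd (fun a b => f (i.succAbove a) (i.succAbove b)) *
      ∏ j : Fin n, if i < i.succAbove j then f i (i.succAbove j) else f (i.succAbove j) i := by
  unfold pairProd
  rw [Fin.prod_univ_succAbove _ i, Fin.prod_univ_succAbove _ i]
  simp only [lt_irrefl, if_false, one_mul]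
  have h : ∀ a : Fin n, (∏ j : Fin (n + 1), if i.succAbove a < j then f (i.succAbove a) j else 1) =
      (if i.succAbove a < i then f (i.succAbove a) i else 1) *
      ∏ b : Fin n, if a < b then f (i.succAbove a) (i.succAbove b) else 1 := by
    intro a
    rw [Fin.prod_univ_succAbove _ i]
    simp only [(Fin.strictMono_succAbove i).lt_iff_lt]
  simp only [h, Finset.prod_mul_distrib]
  rw [← mul_assoc, mul_comm, ← Finset.prod_mul_distrib]
  congr 1
  refine Finset.prod_congr rfl fun j _ => ?_
  rcases lt_or_gt_of_ne (Fin.succAbove_ne i j) with h | h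
  · simp [h, not_lt.2 h.le]
  · simp [h, not_lt.2 h.le]

theorem pairProd_mul {n : ℕ} (f g : Fin n → Fin n → F) :
    pairProd (fun i j => f i j * g i j) = pairProd f * pairProd g := by
  unfold pairProd
  simp only [← Finset.prod_mul_distrib]
  refine Finset.prod_congr rfl fun i _ => Finset.prod_congr rfl fun j _ => ?_
  split_ifs <;> simp

theorem pairProd_congr {n : ℕ} {f g : Fin n → Fin n → F} (h : ∀ i j, i < j → f i j = g i j) :
    pairProd f = pairProd g := by
  unfold pairProd
  refine Finset.prod_congr rfl fun i _ => Finset.prod_congr rfl fun j _ => ?_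
  split_ifs with hij
  · exact h i j hij
  · rfl

theorem pairProd_ne_zero {n : ℕ} {f : Fin n → Fin n → F} (h : ∀ i j, i < j → f i j ≠ 0) :
    pairProd f ≠ 0 := by
  unfold pairProd
  refine Finset.prod_ne_zero_iff.2 fun i _ => Finset.prod_ne_zero_iff.2 fun j _ => ?_
  split_ifs with hij
  · exact h i j hij
  · exact one_ne_zero

/-- The Vandermonde product `∏_{i < j} (y_i - y_j)`. -/
def vdm {n : ℕ} (y : Fin n → F) : F := pairProd fun i j => y i - y j

theorem vdm_succAbove {n : ℕ} (y : Fin (n + 1) → F) (i : Fin (n + 1)) :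
    vdm y = (-1) ^ (i : ℕ) * vdm (fun a => y (i.succAbove a)) *
      ∏ j : Fin n, (y i - y (i.succAbove j)) := by
  unfold vdm
  rw [pairProd_succAbove _ i, mul_comm ((-1 : F) ^ (i : ℕ)), mul_assoc]
  congr 1
  have h : ∀ j : Fin n, (if i < i.succAbove j then y i - y (i.succAbove j)
      else y (i.succAbove j) - y i) =
      (if (j : ℕ) < i then (-1 : F) else 1) * (y i - y (i.succAbove j)) := by
    intro j
    have : i < i.succAbove j ↔ ¬ (j : ℕ) < i := by
      rw [Fin.lt_succAbove_iff_le_castSucc, not_lt, Fin.le_def]; simp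
    by_cases hj : (j : ℕ) < i
    · simp [this, hj]
    · simp [this, hj]
  simp only [h, Finset.prod_mul_distrib]
  congr 1
  rw [Finset.prod_ite]
  simp only [Finset.prod_const, one_pow, mul_one]
  congr 1
  rw [Fin.card_filter_val_lt, min_eq_right (Nat.lt_succ_iff.1 i.2)]

theorem det_pow_eq_vdm {n : ℕ} (y : Fin n → F) :
    Matrix.det (Matrix.of fun i j : Fin n => y j ^ (n - 1 - (i : ℕ))) = vdm y := by
  have h := Matrix.det_projVandermonde (fun _ => (1 : F)) y
  rw [← Matrix.det_transpose]
  have h2 : (Matrix.of fun i j : Fin n => y j ^ (n - 1 - (i : ℕ)))ᵀ =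
      Matrix.projVandermonde (fun _ => (1 : F)) y := by
    ext i j
    simp only [Matrix.transpose_apply, Matrix.of_apply, Matrix.projVandermonde_apply, one_pow,
      one_mul, Fin.val_rev]
    congr 1
    omega
  rw [h2, h, vdm, pairProd]
  refine Finset.prod_congr rfl fun i _ => ?_
  rw [← Finset.prod_filter]
  refine Finset.prod_congr ?_ fun j _ => by ring
  ext; simp

open Polynomial in
/-- A partial fraction identity: the sum of `∏_{j ≠ i} (y_i - 1/y_j) / (y_i - y_j)`. -/
theorem sum_prod_sub_inv_div [CharZero F] {ι : Type*} [DecidableEq ι] (s : Finset ι) (y : ι → F)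
    (hy : Set.InjOn y s) (h0 : ∀ i ∈ s, y i ≠ 0) (h1 : ∀ i ∈ s, y i ^ 2 ≠ 1) :
    ∑ i ∈ s, ∏ j ∈ s.erase i, ((y i - (y j)⁻¹) / (y i - y j)) =
      if Even s.card then 1 - ∏ i ∈ s, (y i)⁻¹ else 1 := by
  rcases s.eq_empty_or_nonempty with rfl | hs
  · simp
  set f : F[X] := ∏ j ∈ s, (X - C (y j)⁻¹) with hf
  set g : F[X] := ∏ j ∈ s, (X - C (y j)) with hg
  set Y : F := ∏ j ∈ s, (y j)⁻¹ with hY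
  set κ : F[X] := if Even s.card then C Y * X else C (-Y) with hκ
  have hf1 : f.eval 1 = (-1) ^ s.card * Y * g.eval 1 := by
    rw [hf, hg, hY, eval_prod, eval_prod, ← Finset.prod_const, ← Finset.prod_mul_distrib,
      ← Finset.prod_mul_distrib]
    refine Finset.prod_congr rfl fun j hj => ?_
    have := h0 j hj
    simp only [eval_sub, eval_X, eval_C]
    field_simp
    ring
  have hf2 : f.eval (-1) = Y * g.eval (-1) := by
    rw [hf, hg, hY, eval_prod, eval_prod, ← Finset.prod_mul_distrib]
    refine Finset.prod_congr rfl fun j hj => ?_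
    have := h0 j hj
    simp only [eval_sub, eval_X, eval_C]
    field_simp
    ring
  have hfm : f.Monic := monic_prod_of_monic _ _ fun j _ => monic_X_sub_C _
  have hgm : g.Monic := monic_prod_of_monic _ _ fun j _ => monic_X_sub_C _
  have hfd : f.natDegree = s.card := by rw [hf, natDegree_finsetProd_X_sub_C_eq_card]
  have hgd : g.natDegree = s.card := by rw [hg, natDegree_finsetProd_X_sub_C_eq_card]
  have hdvd : (X - C (1 : F)) * (X - C (-1 : F)) ∣ X * f - κ * g := by
    refine IsCoprime.mul_dvd ?_ ?_ ?_
    · apply isCoprime_X_sub_C_of_isUnit_sub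
      norm_num
    · rw [dvd_iff_isRoot, IsRoot.def, eval_sub, eval_mul, eval_mul, hf1, hκ]
      split_ifs with h
      · simp [h.neg_one_pow]
      · simp [(Nat.not_even_iff_odd.1 h).neg_one_pow]
    · rw [dvd_iff_isRoot, IsRoot.def, eval_sub, eval_mul, eval_mul, hf2, hκ]
      split_ifs with h
      · simp
      · simp
  obtain ⟨h, hh⟩ := hdvd
  have hval : ∀ i ∈ s, h.eval (y i) = ∏ j ∈ s.erase i, (y i - (y j)⁻¹) := by
    intro i hi
    have e := congrArg (eval (y i)) hh
    have hgi : g.eval (y i) = 0 := by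
      rw [hg, eval_prod]
      exact Finset.prod_eq_zero hi (by simp)
    have hfi : f.eval (y i) = (y i - (y i)⁻¹) * ∏ j ∈ s.erase i, (y i - (y j)⁻¹) := by
      rw [hf, eval_prod, Finset.mul_prod_erase s (fun j => y i - (y j)⁻¹) hi]
      simp
    simp only [eval_sub, eval_mul, hgi, hfi, eval_X, eval_C] at e
    have h0i := h0 i hi
    have h1i := sub_ne_zero.2 (h1 i hi)
    have e2 : y i * ((y i - (y i)⁻¹) * ∏ j ∈ s.erase i, (y i - (y j)⁻¹)) =
        (y i ^ 2 - 1) * ∏ j ∈ s.erase i, (y i - (y j)⁻¹) := by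
      rw [← mul_assoc, mul_sub, mul_inv_cancel₀ h0i]; ring
    rw [e2] at e
    apply mul_left_cancel₀ h1i
    linear_combination -e
  have hcard : 1 ≤ s.card := hs.card_pos
  have hhd : h.degree < s.card := by
    by_contra! hc
    have hd := congrArg degree hh
    have hl : (X * f - κ * g).degree ≤ ((s.card + 1 : ℕ) : WithBot ℕ) := by
      refine (degree_sub_le _ _).trans (max_le ?_ ?_)
      · refine (degree_mul_le _ _).trans ?_
        rw [degree_X, degree_eq_natDegree hfm.ne_zero, hfd]
        norm_cast
        omega
      · refine (degree_mul_le _ _).trans ?_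
        rw [degree_eq_natDegree hgm.ne_zero, hgd]
        have : κ.degree ≤ 1 := by
          rw [hκ]
          split_ifs
          · exact degree_C_mul_X_le _
          · exact degree_C_le.trans (by norm_num)
        calc κ.degree + (s.card : WithBot ℕ) ≤ 1 + (s.card : WithBot ℕ) := by gcongr
          _ = _ := by norm_cast; omega
    rw [hd, degree_mul, degree_mul, degree_X_sub_C, degree_X_sub_C] at hl
    have : (1 + 1 + (s.card : WithBot ℕ)) ≤ ((s.card + 1 : ℕ) : WithBot ℕ) := le_trans (by gcongr) hl
    norm_cast at this
    omega
  have hcoeff : h.coeff (s.card - 1) = if Even s.card then 1 - Y else 1 := by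
    have e := congrArg (fun p => coeff p (s.card + 1)) hh
    have e1 : ((X - C (1 : F)) * (X - C (-1 : F)) * h).coeff (s.card + 1) =
        h.coeff (s.card - 1) := by
      have : (X - C (1 : F)) * (X - C (-1 : F)) * h = h * X ^ 2 - h := by
        simp only [map_one, map_neg]; ring
      rw [this, coeff_sub, coeff_mul_X_pow', if_pos (by omega),
        coeff_eq_zero_of_degree_lt (n := s.card + 1), sub_zero]
      · congr 1
      · exact hhd.trans (by norm_cast; omega)
    rw [← e1, ← e]
    simp only [coeff_sub]
    rw [mul_comm X, coeff_mul_X, hκ]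
    have hfc : f.coeff s.card = 1 := by rw [← hfd]; exact hfm
    have hgc : g.coeff s.card = 1 := by rw [← hgd]; exact hgm
    split_ifs with hev
    · rw [mul_assoc, mul_comm X, coeff_C_mul, coeff_mul_X, hfc, hgc]; ring
    · rw [coeff_C_mul, hfc, coeff_eq_zero_of_natDegree_lt (by omega)]; ring
  have := Lagrange.coeff_eq_sum hy (P := h) hhd
  rw [← hcoeff, this]
  refine Finset.sum_congr rfl fun i hi => ?_
  rw [hval i hi, Finset.prod_div_distrib]

/-- Invert the variables `y j` for which `ε j` holds. -/
def flipVars {n : ℕ} (ε : Fin n → Bool) (y : Fin n → F) (j : Fin n) : F :=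
  if ε j then (y j)⁻¹ else y j

/-- The number of inverted variables modulo two. -/
def flipParity {n : ℕ} (ε : Fin n → Bool) : ZMod 2 := ∑ j, if ε j then 1 else 0

/-- The product `∏_{i < j} 1 / (1 - u_i u_j)`. -/
def pairInv {n : ℕ} (u : Fin n → F) : F := pairProd fun i j => (1 - u i * u j)⁻¹

/-- A single term of the Weyl-type sums `weylHalf`. -/
def weylTerm {n : ℕ} (m : ℕ) (y : Fin n → F) (ε : Fin n → Bool) : F :=
  (∏ j, if ε j then y j ^ m else 1) * pairInv (flipVars ε y)

/-- Weyl-type sum for a half-spin character: the sum over the sign vectors of parity `b`. -/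
def weylHalf {n : ℕ} (b : ZMod 2) (m : ℕ) (y : Fin n → F) : F :=
  ∑ ε : Fin n → Bool, if flipParity ε = b then weylTerm m y ε else 0

/-- The variables are nonzero, distinct, and no product of two of them (or square) is `1`. -/
structure GenericVars {n : ℕ} (y : Fin n → F) : Prop where
  ne_zero : ∀ i, y i ≠ 0
  inj : Function.Injective y
  mul_ne_one : ∀ i j, y i * y j ≠ 1

theorem GenericVars.succAbove {n : ℕ} {y : Fin (n + 1) → F} (h : GenericVars y)
    (i : Fin (n + 1)) : GenericVars fun a => y (i.succAbove a) :=
  ⟨fun _ => h.ne_zero _, fun _ _ e => Fin.succAbove_right_injective (h.inj e),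
    fun _ _ => h.mul_ne_one _ _⟩

theorem GenericVars.flipVars {n : ℕ} {y : Fin n → F} (h : GenericVars y)
    (ε : Fin n → Bool) : GenericVars (flipVars ε y) := by
  refine ⟨fun i => ?_, fun i j e => ?_, fun i j e => ?_⟩
  · have := h.ne_zero i
    unfold _root_.flipVars
    split_ifs <;> simpa
  · unfold _root_.flipVars at e
    have hi := h.ne_zero i
    have hj := h.ne_zero j
    split_ifs at e
    · exact h.inj (inv_injective e)
    · exact absurd (by rw [← e, mul_inv_cancel₀ hi]) (h.mul_ne_one i j)
    · exact absurd (by rw [e, inv_mul_cancel₀ hj]) (h.mul_ne_one i j)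
    · exact h.inj e
  · unfold _root_.flipVars at e
    have hi := h.ne_zero i
    have hj := h.ne_zero j
    split_ifs at e with h1 h2 h2
    · exact h.mul_ne_one i j (by rw [← _root_.inv_inj, mul_inv, e, inv_one])
    · have := h.inj ((inv_mul_eq_one₀ hi).1 e)
      simp_all
    · have := h.inj ((mul_inv_eq_one₀ hj).1 e)
      simp_all
    · exact h.mul_ne_one i j e

theorem vdm_ne_zero {n : ℕ} {y : Fin n → F} (h : Function.Injective y) : vdm y ≠ 0 :=
  pairProd_ne_zero fun _ _ hij => sub_ne_zero.2 (h.ne hij.ne)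

theorem sum_insertNth_true {n : ℕ} (i : Fin (n + 1)) (f : (Fin (n + 1) → Bool) → F) :
    ∑ ε : Fin n → Bool, f (i.insertNth true ε) = ∑ ε, if ε i then f ε else 0 := by
  rw [← (Fin.insertNthEquiv (fun _ => Bool) i).sum_comp, Fintype.sum_prod_type, Fintype.sum_bool]
  simp [Fin.insertNthEquiv]

theorem flipParity_insertNth_true {n : ℕ} (i : Fin (n + 1)) (ε : Fin n → Bool) :
    flipParity (i.insertNth true ε : Fin (n + 1) → Bool) = flipParity ε + 1 := by
  unfold flipParity
  rw [Fin.sum_univ_succAbove _ i]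
  simp [add_comm]

theorem flipParity_eq_card {n : ℕ} (ε : Fin n → Bool) :
    flipParity ε = ((Finset.univ.filter fun j => ε j = true).card : ZMod 2) := by
  unfold flipParity
  rw [← Finset.sum_filter]
  simp

theorem weylTerm_insertNth_true {n : ℕ} (m : ℕ) {y : Fin (n + 1) → F} (hy : GenericVars y)
    (i : Fin (n + 1)) (ε : Fin n → Bool) :
    y i ^ (m + n) * weylTerm m (fun a => y (i.succAbove a)) ε =
      (∏ j, (y i - y (i.succAbove j))) *
      (weylTerm m y (i.insertNth true ε) *
        ∏ j ∈ (Finset.univ.filter fun j =>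
          (i.insertNth true ε : Fin (n + 1) → Bool) j = true).erase i,
          ((y i - (y j)⁻¹) / (y i - y j))) := by
  have hprod : ∏ j ∈ (Finset.univ.filter fun j =>
      (i.insertNth true ε : Fin (n + 1) → Bool) j = true).erase i,
          ((y i - (y j)⁻¹) / (y i - y j)) =
      ∏ j : Fin n, if ε j then
        ((y i - (y (i.succAbove j))⁻¹) / (y i - y (i.succAbove j))) else 1 := by
    have : (Finset.univ.filter fun j =>
        (i.insertNth true ε : Fin (n + 1) → Bool) j = true).erase i =
        (Finset.univ.filter fun j => j ≠ i ∧
        (i.insertNth true ε : Fin (n + 1) → Bool) j = true) := by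
      ext; simp
    rw [this, Finset.prod_filter, Fin.prod_univ_succAbove _ i]
    simp
  have hpair : pairInv (flipVars (i.insertNth true ε) y) =
      pairInv (flipVars ε fun a => y (i.succAbove a)) *
      ∏ j, (1 - (y i)⁻¹ * flipVars ε (fun a => y (i.succAbove a)) j)⁻¹ := by
    unfold pairInv
    rw [pairProd_succAbove _ i]
    congr 1
    · simp [flipVars]
    · refine Finset.prod_congr rfl fun j _ => ?_
      split_ifs
      · simp [flipVars]
      · rw [mul_comm (flipVars _ _ _)]
        simp [flipVars]
  rw [hprod]
  unfold weylTerm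
  rw [hpair, Fin.prod_univ_succAbove _ i]
  simp only [Fin.insertNth_apply_same, if_true, Fin.insertNth_apply_succAbove]
  have key : y i ^ n = ∏ j : Fin n, ((y i - y (i.succAbove j)) *
      ((1 - (y i)⁻¹ * flipVars ε (fun a => y (i.succAbove a)) j)⁻¹ *
      if ε j then ((y i - (y (i.succAbove j))⁻¹) / (y i - y (i.succAbove j))) else 1)) := by
    rw [← Fin.prod_const]
    refine Finset.prod_congr rfl fun j _ => ?_
    have h0 := hy.ne_zero i
    have hj0 := hy.ne_zero (i.succAbove j)
    have hne : y i - y (i.succAbove j) ≠ 0 :=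
      sub_ne_zero.2 (hy.inj.ne (Fin.succAbove_ne i j).symm)
    have hne2 : y i * y (i.succAbove j) - 1 ≠ 0 := sub_ne_zero.2 (hy.mul_ne_one _ _)
    unfold flipVars
    split_ifs
    · have : 1 - (y i)⁻¹ * (y (i.succAbove j))⁻¹ =
          (y i * y (i.succAbove j) - 1) / (y i * y (i.succAbove j)) := by
        field_simp
      rw [this]
      field_simp
    · have : 1 - (y i)⁻¹ * (y (i.succAbove j)) =
          (y i - y (i.succAbove j)) / y i := by
        field_simp
      rw [this]
      field_simp
  rw [pow_add, key, Finset.prod_mul_distrib, Finset.prod_mul_distrib]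
  ring

theorem weyl_row_expansion [CharZero F] {n : ℕ} (m : ℕ) (b : ZMod 2) {y : Fin (n + 1) → F}
    (hy : GenericVars y) :
    ∑ i : Fin (n + 1), (-1) ^ (i : ℕ) * y i ^ (m + n) *
      (vdm (fun a => y (i.succAbove a)) * weylHalf b m (fun a => y (i.succAbove a))) =
    vdm y * ∑ ε : Fin (n + 1) → Bool, if flipParity ε = b + 1 then
      weylTerm m y ε * (if flipParity ε = 0 then 1 - ∏ j, (if ε j then (y j)⁻¹ else 1) else 1)
      else 0 := by
  have h1 : ∀ i : Fin (n + 1), (-1) ^ (i : ℕ) * y i ^ (m + n) *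
      (vdm (fun a => y (i.succAbove a)) * weylHalf b m (fun a => y (i.succAbove a))) =
      vdm y * ∑ ε : Fin (n + 1) → Bool, if ε i then (if flipParity ε = b + 1 then
        weylTerm m y ε * ∏ j ∈ (Finset.univ.filter fun j => ε j = true).erase i,
          ((y i - (y j)⁻¹) / (y i - y j)) else 0) else 0 := by
    intro i
    rw [← sum_insertNth_true i (fun ε => if flipParity ε = b + 1 then
        weylTerm m y ε * ∏ j ∈ (Finset.univ.filter fun j => ε j = true).erase i,
          ((y i - (y j)⁻¹) / (y i - y j)) else 0), vdm_succAbove y i, weylHalf,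
          Finset.mul_sum, Finset.mul_sum, Finset.mul_sum]
    refine Finset.sum_congr rfl fun ε _ => ?_
    rw [flipParity_insertNth_true]
    simp only [add_left_inj]
    split_ifs
    · rw [mul_assoc (_ * _) (∏ j, _), ← weylTerm_insertNth_true m hy i ε]
      ring
    · simp
  simp only [h1]
  rw [← Finset.mul_sum, Finset.sum_comm]
  congr 1
  refine Finset.sum_congr rfl fun ε _ => ?_
  split_ifs with hb
  all_goals try simp only [ite_self, Finset.sum_const_zero]
  all_goals
    rw [← Finset.sum_filter, ← Finset.mul_sum, sum_prod_sub_inv_div _ _ hy.inj.injOn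
      (fun i _ => hy.ne_zero i) (fun i _ => by rw [pow_two]; exact hy.mul_ne_one i i)]
    rename_i h2
    rw [flipParity_eq_card, ZMod.natCast_eq_zero_iff_even] at h2
    simp only [h2, if_true, if_false, Finset.prod_filter]

theorem weyl_row_expansion_even [CharZero F] {n : ℕ} (m : ℕ) {y : Fin (n + 1) → F}
    (hy : GenericVars y) :
    ∑ i : Fin (n + 1), (-1) ^ (i : ℕ) * y i ^ (m + n) *
      (vdm (fun a => y (i.succAbove a)) * weylHalf 0 m (fun a => y (i.succAbove a))) =
    vdm y * weylHalf 1 m y := by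
  rw [weyl_row_expansion m 0 hy]
  congr 1
  refine Finset.sum_congr rfl fun ε _ => ?_
  rw [zero_add]
  split_ifs with h1 h2
  · rw [h1] at h2; exact absurd h2 (by decide)
  · simp
  · rfl

theorem weyl_row_expansion_odd [CharZero F] {n : ℕ} (m : ℕ) {y : Fin (n + 1) → F}
    (hy : GenericVars y) :
    ∑ i : Fin (n + 1), (-1) ^ (i : ℕ) * y i ^ (m + 1 + n) *
      (vdm (fun a => y (i.succAbove a)) * weylHalf 1 (m + 1) (fun a => y (i.succAbove a))) =
    vdm y * weylHalf 0 (m + 1) y - vdm y * weylHalf 0 m y := by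
  rw [weyl_row_expansion (m + 1) 1 hy, ← mul_sub]
  congr 1
  unfold weylHalf
  rw [← Finset.sum_sub_distrib]
  refine Finset.sum_congr rfl fun ε _ => ?_
  rw [show (1 : ZMod 2) + 1 = 0 from by decide]
  split_ifs with h1
  · rw [mul_sub, mul_one]
    congr 1
    unfold weylTerm
    rw [mul_right_comm, ← Finset.prod_mul_distrib]
    congr 1
    refine Finset.prod_congr rfl fun j _ => ?_
    split_ifs
    · rw [pow_succ, mul_assoc, mul_inv_cancel₀ (hy.ne_zero j), mul_one]
    · simp
  · simp

theorem weylHalf_zero_flip {n : ℕ} (y : Fin (n + 1) → F) :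
    weylHalf 0 0 y = weylHalf 1 0 (flipVars (fun j => decide (j = 0)) y) := by
  unfold weylHalf
  let e : (Fin (n + 1) → Bool) ≃ (Fin (n + 1) → Bool) :=
    Equiv.piCongrRight fun j => if j = 0 then Equiv.boolNot else Equiv.refl _
  rw [← e.sum_comp]
  have he0 : ∀ ε, e ε 0 = !ε 0 := fun ε => by simp [e]
  have he : ∀ ε j, j ≠ 0 → e ε j = ε j := fun ε j hj => by simp [e, hj]
  refine Finset.sum_congr rfl fun ε _ => ?_
  have hp : flipParity (e ε) = flipParity ε + 1 := by
    unfold flipParity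
    rw [Fin.sum_univ_succ, Fin.sum_univ_succ, he0]
    simp only [he _ _ (Fin.succ_ne_zero _)]
    have h2 : (1 : ZMod 2) + 1 = 0 := by decide
    cases ε 0
    · simp [add_comm]
    · simp only [Bool.not_true, Bool.false_eq_true, if_false, if_true, add_right_comm _ _ (1 : ZMod 2), h2]
  have ht : weylTerm 0 y (e ε) = weylTerm 0 (flipVars (fun j => decide (j = 0)) y) ε := by
    unfold weylTerm
    simp only [pow_zero, ite_self]
    congr 2
    ext j
    unfold flipVars
    by_cases hj : j = 0
    · subst hj
      rw [he0]
      cases ε 0 <;> simp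
    · rw [he _ _ hj]
      simp [hj]
  have h2 : ∀ p : ZMod 2, p + 1 = 0 ↔ p = 1 := by decide
  simp only [hp, ht, h2]

theorem sum_vdm_succAbove {n : ℕ} (y : Fin (n + 1) → F) :
    ∑ i : Fin (n + 1), (-1) ^ (i : ℕ) * y i ^ n * vdm (fun a => y (i.succAbove a)) = vdm y := by
  rw [← det_pow_eq_vdm y, Matrix.det_succ_row_zero]
  refine Finset.sum_congr rfl fun i _ => ?_
  rw [← det_pow_eq_vdm]
  congr 2
  ext a b
  simp only [Matrix.submatrix_apply, Matrix.of_apply, Fin.val_succ]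
  congr 1
  omega

theorem weylHalf_zero [CharZero F] {n : ℕ} {y : Fin n → F} (hy : GenericVars y) :
    weylHalf 0 0 y = 1 ∧ (n ≠ 0 → weylHalf 1 0 y = 1) := by
  induction n with
  | zero => simp [weylHalf, flipParity, weylTerm, pairInv, pairProd]
  | succ n ih =>
    have h1 : ∀ {z : Fin (n + 1) → F}, GenericVars z → weylHalf 1 0 z = 1 := by
      intro z hz
      have h := weyl_row_expansion_even 0 hz
      simp only [fun i => (ih (hz.succAbove i)).1, mul_one, zero_add] at h
      rw [sum_vdm_succAbove] at h
      exact (mul_left_cancel₀ (vdm_ne_zero hz.inj) (by rw [mul_one]; exact h)).symm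
    exact ⟨by rw [weylHalf_zero_flip]; exact h1 (hy.flipVars _), fun _ => h1 hy⟩

/-- The length of the `c`-th column of `lam`, modulo two. -/
def colParity {n : ℕ} (lam : Fin n → ℕ) (c : ℕ) : ZMod 2 := ∑ j, if c ≤ lam j then 1 else 0

/-- The partitions in the rectangle `(m^n)` whose columns all have length of parity `b`. -/
def colSet (b : ZMod 2) (m n : ℕ) : Finset (Fin n → ℕ) :=
  (Fintype.piFinset fun _ => Finset.range (m + 1)).filter fun lam =>
    Antitone lam ∧ ∀ c, 1 ≤ c → c ≤ m → colParity lam c = b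

theorem mem_colSet {b : ZMod 2} {m n : ℕ} {lam : Fin n → ℕ} : lam ∈ colSet b m n ↔
    (∀ i, lam i ≤ m) ∧ Antitone lam ∧ ∀ c, 1 ≤ c → c ≤ m → colParity lam c = b := by
  simp [colSet, Fintype.mem_piFinset]

theorem antitone_cons_iff {n : ℕ} {m : ℕ} {lam : Fin n → ℕ} :
    Antitone (Fin.cons m lam : Fin (n + 1) → ℕ) ↔ (∀ i, lam i ≤ m) ∧ Antitone lam := by
  constructor
  · intro h
    exact ⟨fun i => by simpa using h (Fin.zero_le i.succ),
      fun i j hij => by simpa using h (Fin.succ_le_succ_iff.2 hij)⟩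
  · rintro ⟨h1, h2⟩ i j
    refine Fin.cases ?_ (fun i => ?_) i <;> refine Fin.cases ?_ (fun j => ?_) j
    · simp
    · simpa using h1 j
    · simp
    · simpa using fun hij => h2 hij

theorem colParity_cons {n : ℕ} (m : ℕ) (lam : Fin n → ℕ) (c : ℕ) :
    colParity (Fin.cons m lam : Fin (n + 1) → ℕ) c =
      (if c ≤ m then 1 else 0) + colParity lam c := by
  unfold colParity
  rw [Fin.sum_univ_succ]
  simp

theorem cons_mem_colSet {b : ZMod 2} {m n : ℕ} {lam : Fin n → ℕ} :
    (Fin.cons m lam : Fin (n + 1) → ℕ) ∈ colSet (b + 1) m (n + 1) ↔ lam ∈ colSet b m n := by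
  have hc : (∀ i, (Fin.cons m lam : Fin (n + 1) → ℕ) i ≤ m) ↔ ∀ i, lam i ≤ m := by
    rw [Fin.forall_fin_succ]; simp
  have hp : (∀ c, 1 ≤ c → c ≤ m → colParity (Fin.cons m lam : Fin (n + 1) → ℕ) c = b + 1) ↔
      ∀ c, 1 ≤ c → c ≤ m → colParity lam c = b := by
    refine forall_congr' fun c => forall_congr' fun _ => forall_congr' fun h => ?_
    rw [colParity_cons, if_pos h, add_comm, add_left_inj]
  rw [mem_colSet, mem_colSet, hc, hp, antitone_cons_iff]
  tauto

/-- The alternant `det (y_j^{λ_i + n - i})`. -/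
def alternant {n : ℕ} (y : Fin n → F) (lam : Fin n → ℕ) : F :=
  Matrix.det (Matrix.of fun i j : Fin n => y j ^ (lam i + (n - 1 - (i : ℕ))))

theorem alternant_cons {n : ℕ} (y : Fin (n + 1) → F) (m : ℕ) (lam : Fin n → ℕ) :
    alternant y (Fin.cons m lam) = ∑ i : Fin (n + 1), (-1) ^ (i : ℕ) * y i ^ (m + n) *
      alternant (fun a => y (i.succAbove a)) lam := by
  unfold alternant
  rw [Matrix.det_succ_row_zero]
  refine Finset.sum_congr rfl fun i _ => ?_
  congr 2
  ext a b
  simp only [Matrix.submatrix_apply, Matrix.of_apply, Fin.val_succ, Fin.cons_succ]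
  congr 2
  omega

theorem colSet_zero (n : ℕ) : colSet 0 0 n = {fun _ => 0} := by
  ext lam
  rw [mem_colSet, Finset.mem_singleton]
  constructor
  · rintro ⟨h, -⟩
    ext i
    exact Nat.le_zero.1 (h i)
  · rintro rfl
    exact ⟨fun _ => le_rfl, antitone_const, fun c h1 h2 => by omega⟩

theorem colParity_eq_zero {n : ℕ} {lam : Fin n → ℕ} {c : ℕ} (h : ∀ i, lam i < c) :
    colParity lam c = 0 :=
  Finset.sum_eq_zero fun i _ => by rw [if_neg (not_le.2 (h i))]

theorem colSet_one_succ (m n : ℕ) :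
    colSet 1 (m + 1) (n + 1) = (colSet 0 (m + 1) n).image (Fin.cons (m + 1)) := by
  ext lam
  rw [Finset.mem_image]
  constructor
  · intro h
    have hl := h
    rw [mem_colSet] at h
    obtain ⟨h1, h2, h3⟩ := h
    have h0 : lam 0 = m + 1 := by
      by_contra hne
      have hlt : lam 0 < m + 1 := lt_of_le_of_ne (h1 0) hne
      have := h3 (m + 1) (by omega) le_rfl
      rw [colParity_eq_zero fun i => (h2 (Fin.zero_le i)).trans_lt hlt] at this
      exact absurd this (by decide)
    have e : (Fin.cons (m + 1) (Fin.tail lam) : Fin (n + 1) → ℕ) = lam := by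
      rw [← h0]; exact Fin.cons_self_tail lam
    refine ⟨Fin.tail lam, ?_, e⟩
    rw [← cons_mem_colSet, e, zero_add]
    exact hl
  · rintro ⟨mu, hmu, rfl⟩
    simpa using cons_mem_colSet.2 hmu

theorem colSet_zero_succ (m n : ℕ) :
    colSet 0 (m + 1) (n + 1) =
      colSet 0 m (n + 1) ∪ (colSet 1 (m + 1) n).image (Fin.cons (m + 1)) := by
  have h11 : (1 : ZMod 2) + 1 = 0 := by decide
  ext lam
  rw [Finset.mem_union, Finset.mem_image]
  constructor
  · intro h
    have hl := h
    rw [mem_colSet] at h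
    obtain ⟨h1, h2, h3⟩ := h
    by_cases h0 : lam 0 = m + 1
    · right
      have e : (Fin.cons (m + 1) (Fin.tail lam) : Fin (n + 1) → ℕ) = lam := by
        rw [← h0]; exact Fin.cons_self_tail lam
      refine ⟨Fin.tail lam, ?_, e⟩
      rw [← cons_mem_colSet, e, h11]
      exact hl
    · left
      have hlt : lam 0 < m + 1 := lt_of_le_of_ne (h1 0) h0
      rw [mem_colSet]
      exact ⟨fun i => Nat.lt_succ_iff.1 ((h2 (Fin.zero_le i)).trans_lt hlt), h2,
        fun c hc1 hc2 => h3 c hc1 (by omega)⟩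
  · rintro (h | ⟨mu, hmu, rfl⟩)
    · rw [mem_colSet] at h ⊢
      refine ⟨fun i => (h.1 i).trans (by omega), h.2.1, fun c hc1 hc2 => ?_⟩
      rcases Nat.lt_or_ge m c with hc | hc
      · exact colParity_eq_zero fun i => (h.1 i).trans_lt hc
      · exact h.2.2 c hc1 hc
    · simpa [h11] using cons_mem_colSet.2 hmu

theorem disjoint_colSet_image_cons (m n : ℕ) :
    Disjoint (colSet 0 m (n + 1)) ((colSet 1 (m + 1) n).image (Fin.cons (m + 1))) := by
  rw [Finset.disjoint_left]
  intro lam h h2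
  obtain ⟨mu, -, rfl⟩ := Finset.mem_image.1 h2
  have := (mem_colSet.1 h).1 0
  simp at this

theorem sum_image_cons_alternant {n : ℕ} (b : ZMod 2) (m : ℕ) (y : Fin (n + 1) → F) :
    ∑ lam ∈ (colSet b m n).image (Fin.cons m), alternant y lam =
      ∑ i : Fin (n + 1), (-1) ^ (i : ℕ) * y i ^ (m + n) *
        ∑ lam ∈ colSet b m n, alternant (fun a => y (i.succAbove a)) lam := by
  rw [Finset.sum_image fun _ _ _ _ h => Fin.cons_right_injective (α := fun _ => ℕ) _ h]
  simp only [alternant_cons, Finset.mul_sum]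
  rw [Finset.sum_comm]

/-- The bounded Littlewood identity for partitions all of whose columns have even (odd) length. -/
theorem sum_colSet_alternant [CharZero F] {n : ℕ} {y : Fin n → F} (hy : GenericVars y) :
    (∀ m, ∑ lam ∈ colSet 0 m n, alternant y lam = vdm y * weylHalf 0 m y) ∧
    (∀ m, ∑ lam ∈ colSet 1 (m + 1) n, alternant y lam = vdm y * weylHalf 1 (m + 1) y) := by
  induction n with
  | zero =>
    have hv : vdm y = 1 := by simp [vdm, pairProd]
    have hp : ∀ ε : Fin 0 → Bool, flipParity ε = 0 := fun ε => by simp [flipParity]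
    constructor
    · intro m
      have : colSet 0 m 0 = {fun _ => 0} := by
        ext lam
        rw [mem_colSet, Finset.mem_singleton]
        refine ⟨fun _ => Subsingleton.elim _ _, ?_⟩
        rintro rfl
        exact ⟨fun i => i.elim0, fun i => i.elim0, fun c _ _ => by simp [colParity]⟩
      rw [this, Finset.sum_singleton, hv]
      simp [alternant, weylHalf, hp, weylTerm, pairInv, pairProd]
    · intro m
      have : colSet 1 (m + 1) 0 = ∅ := by
        ext lam
        simp only [mem_colSet, Finset.notMem_empty, iff_false]
        rintro ⟨-, -, h⟩
        have := h 1 le_rfl (by omega)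
        simp [colParity] at this
      rw [this, Finset.sum_empty]
      simp [weylHalf, hp]
  | succ n ih =>
    constructor
    · intro m
      induction m with
      | zero =>
        rw [colSet_zero, Finset.sum_singleton, (weylHalf_zero hy).1, mul_one, ← det_pow_eq_vdm]
        simp [alternant]
      | succ m ihm =>
        rw [colSet_zero_succ, Finset.sum_union (disjoint_colSet_image_cons m n), ihm,
          sum_image_cons_alternant]
        simp only [fun i => (ih (hy.succAbove i)).2 m]
        rw [weyl_row_expansion_odd m hy]
        ring
    · intro m
      rw [colSet_one_succ, sum_image_cons_alternant]
      simp only [fun i => (ih (hy.succAbove i)).1 (m + 1)]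
      exact weyl_row_expansion_even (m + 1) hy

theorem flipVars_flipVars {n : ℕ} (δ ε : Fin n → Bool) (w : Fin n → F) :
    flipVars δ (flipVars ε w) = flipVars (fun j => xor (δ j) (ε j)) w := by
  ext j
  simp only [flipVars]
  rcases Bool.eq_false_or_eq_true (δ j) with h | h <;>
    rcases Bool.eq_false_or_eq_true (ε j) with h' | h' <;> simp [h, h']

/-- The character `so^D_{((m/2)^n)}` as a sum over sign vectors, `w j` being `x_j^{1/2}`. -/
def spinSum {n : ℕ} (m : ℕ) (w : Fin n → F) : F :=
  ∑ δ : Fin n → Bool, (∏ j, flipVars δ w j ^ m) *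
    pairInv fun j => (flipVars δ w j ^ 2)⁻¹

theorem spinSum_flipVars {n : ℕ} (m : ℕ) (ε : Fin n → Bool) (w : Fin n → F) :
    spinSum m (flipVars ε w) = spinSum m w := by
  unfold spinSum
  simp only [flipVars_flipVars]
  have h : Function.Involutive fun (δ : Fin n → Bool) (j : Fin n) => xor (δ j) (ε j) := by
    intro δ; ext j; simp
  exact Equiv.sum_comp h.toPerm fun δ => (∏ j, flipVars δ w j ^ m) *
    pairInv fun j => (flipVars δ w j ^ 2)⁻¹

theorem weylHalf_add {n : ℕ} (m : ℕ) {w : Fin n → F} (hw : ∀ i, w i ≠ 0) :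
    weylHalf 0 m (fun j => w j ^ 2) + weylHalf 1 m (fun j => w j ^ 2) =
      (∏ j, w j ^ m) * spinSum m w := by
  unfold weylHalf spinSum
  rw [← Finset.sum_add_distrib, Finset.mul_sum]
  have h : Function.Involutive fun (δ : Fin n → Bool) (j : Fin n) => !δ j := by
    intro δ; ext j; simp
  rw [← Equiv.sum_comp h.toPerm fun δ => (∏ j, w j ^ m) * ((∏ j, flipVars δ w j ^ m) *
    pairInv fun j => (flipVars δ w j ^ 2)⁻¹)]
  refine Finset.sum_congr rfl fun δ _ => ?_
  have h01 : ∀ p : ZMod 2, p = 0 ∧ p ≠ 1 ∨ p ≠ 0 ∧ p = 1 := by decide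
  have e1 : ((if flipParity δ = 0 then weylTerm m (fun j => w j ^ 2) δ else 0) +
      if flipParity δ = 1 then weylTerm m (fun j => w j ^ 2) δ else 0) =
      weylTerm m (fun j => w j ^ 2) δ := by
    rcases h01 (flipParity δ) with ⟨h, h'⟩ | ⟨h, h'⟩
    · rw [if_pos h, if_neg h', add_zero]
    · rw [if_neg h, if_pos h', zero_add]
  rw [e1, weylTerm, ← mul_assoc, ← Finset.prod_mul_distrib]
  congr 1
  · refine Finset.prod_congr rfl fun j _ => ?_
    have := hw j
    simp only [Function.Involutive.coe_toPerm, flipVars]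
    rcases Bool.eq_false_or_eq_true (δ j) with h | h
    · simp only [h, if_true, Bool.not_true, Bool.false_eq_true, if_false]
      ring
    · simp [h, this]
  · congr 1
    ext j
    simp only [Function.Involutive.coe_toPerm, flipVars]
    rcases Bool.eq_false_or_eq_true (δ j) with h | h <;> simp [h]

theorem det_sum_bool {n : ℕ} (g : Fin n → Fin n → Bool → F) :
    Matrix.det (Matrix.of fun i j => g i j false + g i j true) =
      ∑ ε : Fin n → Bool, Matrix.det (Matrix.of fun i j => g i j (ε j)) := by
  have h := (Matrix.detRowAlternating (R := F) (n := Fin n)).toMultilinearMap.map_sum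
    (fun (j : Fin n) (s : Bool) (i : Fin n) => g i j s)
  rw [← Matrix.det_transpose]
  have e : (Matrix.of fun i j => g i j false + g i j true)ᵀ =
      fun j => ∑ s : Bool, fun i => g i j s := by
    ext j i
    simp [add_comm]
  rw [e]
  refine h.trans (Finset.sum_congr rfl fun ε _ => ?_)
  rw [← Matrix.det_transpose]
  rfl

theorem det_zpow_eq_alternant {n : ℕ} {w : Fin n → F} (hw : ∀ i, w i ≠ 0) (lam : Fin n → ℕ)
    (b : ℤ) :
    Matrix.det (Matrix.of fun i j : Fin n =>
      w j ^ (2 * (lam i : ℤ) + b + 2 * ((n : ℤ) - 1 - (i : ℕ)))) =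
      (∏ j, w j ^ b) * alternant (fun j => w j ^ 2) lam := by
  unfold alternant
  rw [← Matrix.det_mul_row]
  congr 1
  ext i j
  have : 2 * (lam i : ℤ) + b + 2 * ((n : ℤ) - 1 - (i : ℕ)) =
      b + ((2 * (lam i + (n - 1 - (i : ℕ))) : ℕ) : ℤ) := by
    have := i.2
    push_cast [show (i : ℕ) ≤ n - 1 by omega, show 1 ≤ n by omega]
    ring
  simp only [Matrix.of_apply]
  rw [this, zpow_add₀ (hw j), zpow_natCast, pow_mul]

theorem alternant_zero {n : ℕ} (y : Fin n → F) : alternant y (fun _ => 0) = vdm y := by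
  simp [alternant, ← det_pow_eq_vdm]

theorem det_zpow_const {n : ℕ} {w : Fin n → F} (hw : ∀ i, w i ≠ 0) (b : ℤ) :
    Matrix.det (Matrix.of fun i j : Fin n => w j ^ (b + 2 * ((n : ℤ) - 1 - (i : ℕ)))) =
      (∏ j, w j ^ b) * vdm fun j => w j ^ 2 := by
  have := det_zpow_eq_alternant hw (fun _ => 0) b
  simpa [alternant_zero] using this

theorem flipVars_ne_zero {n : ℕ} {w : Fin n → F} (hw : ∀ i, w i ≠ 0) (ε : Fin n → Bool)
    (i : Fin n) : flipVars ε w i ≠ 0 := by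
  unfold flipVars
  split_ifs <;> simpa using hw i

theorem flipVars_sq {n : ℕ} (w : Fin n → F) (ε : Fin n → Bool) :
    (fun j => flipVars ε w j ^ 2) = flipVars ε fun j => w j ^ 2 := by
  ext j
  unfold flipVars
  split_ifs <;> simp

theorem vdm_flipVars {n : ℕ} {y : Fin n → F} (hy : GenericVars y) (ε : Fin n → Bool) :
    vdm (flipVars ε y) = (pairProd fun i j => (y i + (y i)⁻¹) - (y j + (y j)⁻¹)) *
      pairInv fun j => (flipVars ε y j)⁻¹ := by
  unfold vdm pairInv
  rw [← pairProd_mul]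
  refine pairProd_congr fun i j hij => ?_
  have ht : ∀ l, y l + (y l)⁻¹ = flipVars ε y l + (flipVars ε y l)⁻¹ := by
    intro l
    unfold flipVars
    split_ifs
    · rw [inv_inv, add_comm]
    · rfl
  have hg := hy.flipVars ε
  have hi := hg.ne_zero i
  have hj := hg.ne_zero j
  have h1 := sub_ne_zero.2 (hg.mul_ne_one i j)
  rw [ht, ht]
  have e : 1 - (flipVars ε y i)⁻¹ * (flipVars ε y j)⁻¹ =
      (flipVars ε y i * flipVars ε y j - 1) / (flipVars ε y i * flipVars ε y j) := by
    field_simp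
  rw [e]
  field_simp
  ring

theorem det_zpow_add_zpow_neg {n : ℕ} (m : ℕ) {z : Fin n → F} (hz : ∀ i, z i ≠ 0)
    (hy : GenericVars fun j => z j ^ 2) :
    Matrix.det (Matrix.of fun i j : Fin n =>
      z j ^ ((m : ℤ) + 2 * ((n : ℤ) - 1 - (i : ℕ))) +
        z j ^ (-((m : ℤ) + 2 * ((n : ℤ) - 1 - (i : ℕ))))) =
      (pairProd fun i j => (z i ^ 2 + (z i ^ 2)⁻¹) - (z j ^ 2 + (z j ^ 2)⁻¹)) *
        spinSum m z := by
  have h := det_sum_bool fun i j s => (if s = true then (z j)⁻¹ else z j) ^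
    ((m : ℤ) + 2 * ((n : ℤ) - 1 - (i : ℕ)))
  simp only [Bool.false_eq_true, if_false, if_true, _root_.inv_zpow'] at h
  rw [h, spinSum, Finset.mul_sum]
  refine Finset.sum_congr rfl fun ε _ => ?_
  refine (det_zpow_const (flipVars_ne_zero hz ε) (m : ℤ)).trans ?_
  rw [flipVars_sq, vdm_flipVars hy]
  simp only [zpow_natCast]
  rw [← flipVars_sq]
  ring

theorem soDD_const [CharZero F] {n m : ℕ} (hn : 1 ≤ n) (hm : 0 < m) {z : Fin n → F}
    (hz : ∀ i, z i ≠ 0) (hy : GenericVars fun j => z j ^ 2) :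
    soDD z (fun _ => (m : ℤ)) = spinSum m z := by
  have h0 := det_zpow_add_zpow_neg 0 hz hy
  have h2 : spinSum 0 z = 2 := by
    have h := weylHalf_add 0 hz
    rw [(weylHalf_zero hy).1, (weylHalf_zero hy).2 (by omega)] at h
    simp only [pow_zero, Finset.prod_const_one, one_mul] at h
    rw [← h]; norm_num
  rw [h2] at h0
  simp only [Nat.cast_zero, zero_add] at h0
  have hne : (pairProd fun i j => (z i ^ 2 + (z i ^ 2)⁻¹) - (z j ^ 2 + (z j ^ 2)⁻¹)) ≠ 0 := by
    refine pairProd_ne_zero fun i j hij => ?_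
    have hi := hy.ne_zero i
    have hj := hy.ne_zero j
    have hn1 := sub_ne_zero.2 (hy.mul_ne_one i j)
    have hn2 := sub_ne_zero.2 (hy.inj.ne hij.ne)
    have hzi := hz i
    have hzj := hz j
    have e : (z i ^ 2 + (z i ^ 2)⁻¹) - (z j ^ 2 + (z j ^ 2)⁻¹) =
        (z i ^ 2 - z j ^ 2) * (z i ^ 2 * z j ^ 2 - 1) / (z i ^ 2 * z j ^ 2) := by
      field_simp
      ring
    rw [e]
    exact div_ne_zero (mul_ne_zero hn2 hn1) (mul_ne_zero hi hj)
  unfold soDD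
  have hm' : (0 : ℤ) < m := by exact_mod_cast hm
  simp only [show 0 < n from hn, hm', dif_pos, if_pos]
  rw [det_zpow_add_zpow_neg m hz hy, h0]
  generalize (pairProd fun i j : Fin n =>
    (z i ^ 2 + (z i ^ 2)⁻¹) - (z j ^ 2 + (z j ^ 2)⁻¹)) = P at hne ⊢
  field_simp

/-- The coefficients of the expansion of the columns of `interMatD` into powers of
`z j` and `(z j)⁻¹`. -/
def interCoeff {n : ℕ} (k : ℕ) (z : Fin n → F) (ε : Fin n → Bool) (j : Fin n) : F :=
  if (j : ℕ) < k then
    (if ε j then -1 else 1) * flipVars ε z j ^ (2 * ((k : ℤ) - n + 1)) /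
      ∏ l ∈ Finset.univ.filter (fun l : Fin n => k ≤ (l : ℕ)),
        (1 - (flipVars ε z j ^ 2)⁻¹ * z l ^ 2)
  else if ε j then 0 else 1

theorem det_interMatD {n : ℕ} (k : ℕ) {z : Fin n → F} (hz : ∀ i, z i ≠ 0) (lam : Fin n → ℕ)
    (b : ℤ) :
    (interMatD k z fun i => 2 * (lam i : ℤ) + b).det =
      ∑ ε : Fin n → Bool, (∏ j, interCoeff k z ε j) * ((∏ j, flipVars ε z j ^ b) *
        alternant (flipVars ε fun j => z j ^ 2) lam) := by
  have h := det_sum_bool fun i j s => interCoeff k z (fun _ => s) j *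
    flipVars (fun _ => s) z j ^ (2 * (lam i : ℤ) + b + 2 * ((n : ℤ) - 1 - (i : ℕ)))
  have e : (Matrix.of fun i j => interCoeff k z (fun _ => false) j *
      flipVars (fun _ => false) z j ^ (2 * (lam i : ℤ) + b + 2 * ((n : ℤ) - 1 - (i : ℕ))) +
      interCoeff k z (fun _ => true) j *
      flipVars (fun _ => true) z j ^ (2 * (lam i : ℤ) + b + 2 * ((n : ℤ) - 1 - (i : ℕ)))) =
      interMatD k z fun i => 2 * (lam i : ℤ) + b := by
    ext i j
    simp only [interMatD, Matrix.of_apply, interCoeff, flipVars, if_true, Bool.false_eq_true,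
      if_false]
    have hj := hz j
    split_ifs
    · rw [inv_pow, inv_inv, one_mul, neg_one_mul, neg_div, neg_mul, ← sub_eq_add_neg]
      congr 1
      · rw [div_mul_eq_mul_div, ← zpow_add₀ hj]
        congr 2
        ring
      · rw [div_mul_eq_mul_div, ← zpow_add₀ (inv_ne_zero hj), _root_.inv_zpow']
        congr 2
        ring
    · simp
  rw [← e, h]
  refine Finset.sum_congr rfl fun ε _ => ?_
  rw [← flipVars_sq, ← det_zpow_eq_alternant (flipVars_ne_zero hz ε), ← Matrix.det_mul_row]
  rfl

theorem sum_det_interMatD [CharZero F] {n : ℕ} (k m : ℕ) (hm : 0 < m) {z : Fin n → F}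
    (hz : ∀ i, z i ≠ 0) (hy : GenericVars fun j => z j ^ 2) (b : ℤ) :
    (∑ lam ∈ colSet 0 m n, (interMatD k z fun i => 2 * (lam i : ℤ) + b).det) +
      (∑ lam ∈ colSet 1 m n, (interMatD k z fun i => 2 * (lam i : ℤ) + b).det) =
    spinSum m z * (interMatD k z fun _ => (m : ℤ) + b).det := by
  obtain ⟨m, rfl⟩ : ∃ m', m = m' + 1 := ⟨m - 1, by omega⟩
  have h0 := det_interMatD k hz (fun _ => 0) (((m + 1 : ℕ) : ℤ) + b)
  simp only [Nat.cast_zero, mul_zero, zero_add, alternant_zero] at h0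
  rw [h0]
  simp only [det_interMatD k hz]
  rw [Finset.sum_comm, Finset.sum_comm (s := colSet 1 (m + 1) n), ← Finset.sum_add_distrib,
    Finset.mul_sum]
  refine Finset.sum_congr rfl fun ε _ => ?_
  have hg := hy.flipVars ε
  have hl := sum_colSet_alternant hg
  simp only [← Finset.mul_sum]
  rw [hl.1, hl.2, ← mul_add, ← mul_add, ← mul_add]
  have hw := weylHalf_add (m + 1) (flipVars_ne_zero hz ε)
  rw [flipVars_sq] at hw
  rw [hw, spinSum_flipVars]
  have hp : ∏ j, flipVars ε z j ^ (((m + 1 : ℕ) : ℤ) + b) =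
      (∏ j, flipVars ε z j ^ (m + 1)) * ∏ j, flipVars ε z j ^ b := by
    rw [← Finset.prod_mul_distrib]
    refine Finset.prod_congr rfl fun j _ => ?_
    rw [zpow_add₀ (flipVars_ne_zero hz ε j), zpow_natCast]
  rw [hp]
  ring

theorem pairProd_append {k r : ℕ} (f : Fin (k + r) → Fin (k + r) → F) :
    pairProd f = pairProd (fun i j => f (Fin.castAdd r i) (Fin.castAdd r j)) *
      (∏ i : Fin k, ∏ l : Fin r, f (Fin.castAdd r i) (Fin.natAdd k l)) *
      pairProd (fun i j => f (Fin.natAdd k i) (Fin.natAdd k j)) := by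
  have h1 : ∀ (i : Fin k) (l : Fin r), Fin.castAdd r i < Fin.natAdd k l := fun i l => by
    simp only [Fin.lt_def, Fin.val_castAdd, Fin.val_natAdd]; omega
  have h2 : ∀ (i : Fin k) (l : Fin r), ¬ Fin.natAdd k l < Fin.castAdd r i := fun i l =>
    (h1 i l).le.not_gt
  have h3 : ∀ i j : Fin k, Fin.castAdd r i < Fin.castAdd r j ↔ i < j := fun i j => by
    simp only [Fin.lt_def, Fin.val_castAdd]
  have h4 : ∀ i j : Fin r, Fin.natAdd k i < Fin.natAdd k j ↔ i < j := fun i j => by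
    simp only [Fin.lt_def, Fin.val_natAdd]; omega
  unfold pairProd
  simp only [Fin.prod_univ_add, h1, h2, h3, h4, if_true, if_false, Finset.prod_const_one, mul_one,
    Finset.prod_mul_distrib, mul_assoc]

theorem prod_filter_le_val {k r : ℕ} (f : Fin (k + r) → F) :
    ∏ l ∈ Finset.univ.filter (fun l : Fin (k + r) => k ≤ (l : ℕ)), f l =
      ∏ l : Fin r, f (Fin.natAdd k l) := by
  rw [Finset.prod_filter, Fin.prod_univ_add]
  have : ∀ i : Fin k, ¬ k ≤ (i : ℕ) := fun i => not_le.2 i.2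
  simp [this]

/-- The numerator of the symplectic character `sp_{(b^k)}`. -/
theorem det_zpow_sub_zpow_neg {k : ℕ} {z : Fin k → F} (hz : ∀ i, z i ≠ 0) (b : ℤ) :
    Matrix.det (Matrix.of fun i j : Fin k =>
      z j ^ (b + 2 * ((k : ℤ) - (i : ℕ))) - z j ^ (-(b + 2 * ((k : ℤ) - (i : ℕ))))) =
    ∑ ε : Fin k → Bool, (∏ j, if ε j then (-1 : F) else 1) *
      ((∏ j, flipVars ε z j ^ (b + 2)) * vdm fun j => flipVars ε z j ^ 2) := by
  have h := det_sum_bool fun i j s => (if s = true then (-1 : F) else 1) *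
    (if s = true then (z j)⁻¹ else z j) ^ (b + 2 + 2 * ((k : ℤ) - 1 - (i : ℕ)))
  have e : ∀ i : Fin k, b + 2 + 2 * ((k : ℤ) - 1 - (i : ℕ)) = b + 2 * ((k : ℤ) - (i : ℕ)) :=
    fun i => by ring
  simp only [Bool.false_eq_true, if_false, if_true, _root_.inv_zpow', one_mul, neg_one_mul,
    ← sub_eq_add_neg, e] at h
  rw [h]
  refine Finset.sum_congr rfl fun ε _ => ?_
  rw [← det_zpow_const (flipVars_ne_zero hz ε), ← Matrix.det_mul_row]
  simp only [e]
  rfl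

theorem det_interMatD_const {k r : ℕ} {z : Fin (k + r) → F} (hz : ∀ i, z i ≠ 0)
    (hy : GenericVars fun j => z j ^ 2) (b : ℤ) :
    (interMatD k z fun _ => b).det =
      Matrix.det (Matrix.of fun i j : Fin k =>
        z (Fin.castAdd r j) ^ (b + 2 * ((k : ℤ) - (i : ℕ))) -
          z (Fin.castAdd r j) ^ (-(b + 2 * ((k : ℤ) - (i : ℕ))))) *
      (∏ l : Fin r, z (Fin.natAdd k l) ^ b) * vdm fun l : Fin r => z (Fin.natAdd k l) ^ 2 := by
  have h := det_interMatD k hz (fun _ => 0) b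
  simp only [Nat.cast_zero, mul_zero, zero_add, alternant_zero] at h
  rw [h, det_zpow_sub_zpow_neg fun j => hz _, ← (Fin.appendEquiv k r).sum_comp,
    Fintype.sum_prod_type, Finset.sum_mul, Finset.sum_mul]
  refine Finset.sum_congr rfl fun ε _ => ?_
  rw [Finset.sum_eq_single (fun _ => false)]
  · have hc : ∀ j : Fin k, interCoeff k z (Fin.append ε fun _ => false) (Fin.castAdd r j) =
        (if ε j then -1 else 1) * flipVars ε (fun j => z (Fin.castAdd r j)) j ^ (2 * (1 - (r : ℤ))) /
        ∏ l : Fin r, (1 - (flipVars ε (fun j => z (Fin.castAdd r j)) j ^ 2)⁻¹ *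
          z (Fin.natAdd k l) ^ 2) := by
      intro j
      unfold interCoeff
      rw [prod_filter_le_val]
      simp only [flipVars, Fin.append_left, Fin.val_castAdd, j.2, if_true]
      congr 3
      push_cast
      ring
    have hn : ∀ l : Fin r, interCoeff k z (Fin.append ε fun _ => false) (Fin.natAdd k l) = 1 := by
      intro l
      simp [interCoeff]
    have hfl : ∀ j : Fin k, flipVars (Fin.append ε fun _ => false) z (Fin.castAdd r j) =
        flipVars ε (fun j => z (Fin.castAdd r j)) j := by
      intro j
      simp [flipVars]
    have hfn : ∀ l : Fin r, flipVars (Fin.append ε fun _ => false) z (Fin.natAdd k l) =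
        z (Fin.natAdd k l) := by
      intro l
      simp [flipVars]
    simp only [Fin.appendEquiv, Equiv.coe_fn_mk]
    rw [← flipVars_sq]
    unfold vdm
    rw [pairProd_append]
    simp only [Fin.prod_univ_add, hc, hn, hfl, hfn, Finset.prod_const_one, mul_one]
    have key : ∀ j : Fin k, (if ε j then (-1 : F) else 1) *
        flipVars ε (fun j => z (Fin.castAdd r j)) j ^ (b + 2) =
        (if ε j then -1 else 1) * flipVars ε (fun j => z (Fin.castAdd r j)) j ^ (2 * (1 - (r : ℤ))) /
        (∏ l : Fin r, (1 - (flipVars ε (fun j => z (Fin.castAdd r j)) j ^ 2)⁻¹ *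
          z (Fin.natAdd k l) ^ 2)) * (flipVars ε (fun j => z (Fin.castAdd r j)) j ^ b *
        ∏ l : Fin r, (flipVars ε (fun j => z (Fin.castAdd r j)) j ^ 2 -
          z (Fin.natAdd k l) ^ 2)) := by
      intro j
      have h0 : flipVars ε (fun j => z (Fin.castAdd r j)) j ≠ 0 :=
        flipVars_ne_zero (fun j => hz _) ε j
      have hne : ∀ l : Fin r, flipVars ε (fun j => z (Fin.castAdd r j)) j ^ 2 -
          z (Fin.natAdd k l) ^ 2 ≠ 0 := by
        intro l
        rw [sub_ne_zero, ← hfl, ← hfn l]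
        have hne := (hy.flipVars (Fin.append ε fun _ => false)).inj.ne
          (a₁ := Fin.castAdd r j) (a₂ := Fin.natAdd k l)
          (by simp only [ne_eq, Fin.ext_iff, Fin.val_castAdd, Fin.val_natAdd]; omega)
        rwa [← flipVars_sq] at hne
      generalize flipVars ε (fun j => z (Fin.castAdd r j)) j = u at h0 hne ⊢
      have hp : ∏ l : Fin r, (u ^ 2 - z (Fin.natAdd k l) ^ 2) =
          (u ^ 2) ^ r * ∏ l : Fin r, (1 - (u ^ 2)⁻¹ * z (Fin.natAdd k l) ^ 2) := by
        rw [← Fin.prod_const r (u ^ 2), ← Finset.prod_mul_distrib]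
        refine Finset.prod_congr rfl fun l _ => ?_
        field_simp
      have hp0 : ∏ l : Fin r, (1 - (u ^ 2)⁻¹ * z (Fin.natAdd k l) ^ 2) ≠ 0 := by
        intro h0'
        rw [h0', mul_zero] at hp
        exact Finset.prod_ne_zero_iff.2 (fun l _ => hne l) hp
      rw [hp]
      have hz2 : u ^ (b + 2) = u ^ (2 * (1 - (r : ℤ))) * (u ^ b * (u ^ 2) ^ r) := by
        rw [← pow_mul, ← zpow_natCast, ← zpow_add₀ h0, ← zpow_add₀ h0]
        congr 1
        push_cast
        ring
      rw [hz2]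
      generalize ∏ l : Fin r, (1 - (u ^ 2)⁻¹ * z (Fin.natAdd k l) ^ 2) = P at hp0 ⊢
      field_simp
    have hk := Finset.prod_congr (rfl : (Finset.univ : Finset (Fin k)) = Finset.univ)
      fun j _ => key j
    simp only [Finset.prod_mul_distrib] at hk ⊢
    linear_combination (-1 : F) * (pairProd fun i j =>
      flipVars ε (fun j => z (Fin.castAdd r j)) i ^ 2 -
      flipVars ε (fun j => z (Fin.castAdd r j)) j ^ 2) *
      (∏ l : Fin r, z (Fin.natAdd k l) ^ b) *
      (pairProd fun i j : Fin r => z (Fin.natAdd k i) ^ 2 - z (Fin.natAdd k j) ^ 2) * hk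
  · intro ε' _ hε'
    obtain ⟨l, hl⟩ := Function.ne_iff.1 hε'
    rw [Finset.prod_eq_zero (Finset.mem_univ (Fin.natAdd k l)), zero_mul]
    have hl' : ε' l = true := by simpa using hl
    simp [interCoeff, Fin.appendEquiv, hl']
  · intro h
    exact absurd (Finset.mem_univ _) h

theorem spInterD_const {k r : ℕ} {z : Fin (k + r) → F} (hz : ∀ i, z i ≠ 0)
    (hy : GenericVars fun j => z j ^ 2) (b : ℤ) :
    spInterD k z (fun _ => b) =
      spD (fun i : Fin k => z (Fin.castAdd r i)) (fun _ => b) *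
        ∏ l : Fin r, z (Fin.natAdd k l) ^ b := by
  have hv : (vdm fun l : Fin r => z (Fin.natAdd k l) ^ 2) ≠ 0 :=
    vdm_ne_zero fun i j h => Fin.natAdd_injective r k (hy.inj h)
  unfold spInterD spD
  have h0 := det_interMatD_const hz hy 0
  simp only [zero_add, zpow_zero, Finset.prod_const_one, mul_one] at h0
  rw [det_interMatD_const hz hy b, h0, mul_div_mul_right _ _ hv, mul_div_right_comm]

theorem genericVars_gen (n : ℕ) : GenericVars fun j => gen n j ^ 2 := by
  have hinj : Function.Injective (algebraMap (MvPolynomial (Fin n) ℚ) (FF n)) :=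
    IsFractionRing.injective _ _
  refine ⟨fun i => ?_, fun i j h => ?_, fun i j h => ?_⟩
  · exact pow_ne_zero _ ((map_ne_zero_iff _ hinj).2 (MvPolynomial.X_ne_zero i))
  · simp only [gen, ← map_pow] at h
    have h' := hinj h
    by_contra hij
    have := congrArg (MvPolynomial.eval fun l => if l = i then (1 : ℚ) else 0) h'
    simp [Ne.symm hij] at this
  · simp only [gen, ← map_pow, ← map_mul] at h
    have h' := hinj (h.trans (map_one _).symm)
    have := congrArg (MvPolynomial.eval fun _ => (0 : ℚ)) h'
    simp at this

theorem sum_filter_eq_sum_colSet {M : Type*} [AddCommMonoid M] {n m : ℕ} (b : ZMod 2)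
    (P : (Fin n → Fin (m + 1)) → Prop)
    (hP : ∀ lam, P lam ↔ Antitone (fun i => (lam i : ℕ)) ∧
      ∀ c, 1 ≤ c → c ≤ m → colParity (fun i => (lam i : ℕ)) c = b) (f : (Fin n → ℕ) → M) :
    ∑ lam ∈ Finset.univ.filter P, f (fun i => (lam i : ℕ)) = ∑ lam ∈ colSet b m n, f lam := by
  refine Finset.sum_bij (fun lam _ i => (lam i : ℕ)) ?_ ?_ ?_ ?_
  · intro lam h
    rw [Finset.mem_filter, hP] at h
    exact mem_colSet.2 ⟨fun i => Nat.lt_succ_iff.1 (lam i).2, h.2⟩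
  · intro a _ b _ h
    ext i
    exact congrFun h i
  · intro lam h
    rw [mem_colSet] at h
    refine ⟨fun i => ⟨lam i, Nat.lt_succ_iff.2 (h.1 i)⟩, ?_, rfl⟩
    rw [Finset.mem_filter, hP]
    exact ⟨Finset.mem_univ _, h.2⟩
  · intros; rfl

theorem colParity_eq_card {n : ℕ} (lam : Fin n → ℕ) (c : ℕ) :
    colParity lam c = ((Finset.univ.filter fun j : Fin n => c ≤ lam j).card : ZMod 2) := by
  unfold colParity
  rw [← Finset.sum_filter]
  simp

/-- **Theorem (main theorem, part (3)).**  For `1 ≤ n`, `0 ≤ k ≤ n`, `m` a positive integer and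
`a = a2/2` a nonnegative half-integer, the sum of the intermediate symplectic characters
`sp^{(k,n-k)}_{λ+(a^n)}(x_1,…,x_k | x_{k+1},…,x_n)` over all partitions `λ ⊆ (m^n)` all of whose
column lengths `λ′_c` (`1 ≤ c ≤ m`) are even, plus the corresponding sum over those all of whose
column lengths are odd, equals `so^D_{((m/2)^n)}(x_1,…,x_n) · sp_{((m/2+a)^k)}(x_1,…,x_k) ·
(x_{k+1} ⋯ x_n)^{m/2+a}`, as an identity in `ℚ(x_1^{1/2}, …, x_n^{1/2})`.
Here `gen n i` plays the role of `x_i^{1/2}`, all weights are doubled, and the column length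
`λ′_c` is the number of indices `j` with `λ_j ≥ c`. -/
theorem sum_spInter_evenodd_columns (n k m : ℕ) (a2 : ℤ) (hn : 1 ≤ n) (hk : k ≤ n)
    (hm : 0 < m) (ha : 0 ≤ a2) :
    ∑ lam ∈ Finset.univ.filter
        (fun lam : Fin n → Fin (m + 1) =>
          (Antitone fun i => (lam i : ℕ)) ∧
          ((∀ c : ℕ, 1 ≤ c → c ≤ m →
              Even (Finset.univ.filter (fun j : Fin n => c ≤ (lam j : ℕ))).card) ∨
           (∀ c : ℕ, 1 ≤ c → c ≤ m →
              Odd (Finset.univ.filter (fun j : Fin n => c ≤ (lam j : ℕ))).card))),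
      spInterD k (gen n) (fun i => 2 * ((lam i : ℕ) : ℤ) + a2) =
    soDD (gen n) (fun _ => (m : ℤ)) *
      spD (fun i : Fin k => gen n (Fin.castLE hk i)) (fun _ => (m : ℤ) + a2) *
      ∏ i ∈ Finset.univ.filter (fun i : Fin n => k ≤ (i : ℕ)), gen n i ^ ((m : ℤ) + a2) := by
  have hy := genericVars_gen n
  have hz : ∀ i, gen n i ≠ 0 := fun i h => hy.ne_zero i (by simp [h])
  rw [soDD_const hn hm hz hy]
  simp only [and_or_left]
  rw [Finset.filter_or, Finset.sum_union]
  · have e0 := sum_filter_eq_sum_colSet (m := m) 0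
      (fun lam : Fin n → Fin (m + 1) => (Antitone fun i => (lam i : ℕ)) ∧
        ∀ c : ℕ, 1 ≤ c → c ≤ m →
          Even (Finset.univ.filter (fun j : Fin n => c ≤ (lam j : ℕ))).card)
      (fun lam => by simp only [colParity_eq_card, ZMod.natCast_eq_zero_iff_even])
      (fun lam => spInterD k (gen n) fun i => 2 * (lam i : ℤ) + a2)
    have e1 := sum_filter_eq_sum_colSet (m := m) 1
      (fun lam : Fin n → Fin (m + 1) => (Antitone fun i => (lam i : ℕ)) ∧
        ∀ c : ℕ, 1 ≤ c → c ≤ m →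
          Odd (Finset.univ.filter (fun j : Fin n => c ≤ (lam j : ℕ))).card)
      (fun lam => by simp only [colParity_eq_card, ZMod.natCast_eq_one_iff_odd])
      (fun lam => spInterD k (gen n) fun i => 2 * (lam i : ℤ) + a2)
    refine Eq.trans (by congr!) ((congrArg₂ (· + ·) e0 e1).trans ?_)
    simp only [spInterD]
    rw [← Finset.sum_div, ← Finset.sum_div, ← add_div, sum_det_interMatD k m hm hz hy a2,
      mul_div_assoc, mul_assoc]
    congr 1
    obtain ⟨r, rfl⟩ := Nat.exists_eq_add_of_le hk
    rw [prod_filter_le_val]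
    exact spInterD_const hz hy _
  · rw [Finset.disjoint_filter]
    rintro lam - ⟨-, h1⟩ ⟨-, h2⟩
    exact Nat.not_even_iff_odd.2 (h2 1 le_rfl hm) (h1 1 le_rfl hm)
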